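/- The inclusion c ⊂ c(F̂) holds and is strict: every convergent sequence x satisfies that limₙ (F̂x)ₙ exists, and the sequence x = (f_{k+1}²) belongs to c(F̂) but not to c. -/

import Mathlib

open Filter Finset Topology

noncomputable section

/-- The Fibonacci sequence with `f 0 = f 1 = 1`, `f (n+2) = f (n+1) + f n`, as a real sequence. -/
def fibR (n : ℕ) : ℝ := (Nat.fib (n + 1) : ℝ)

/-- The Fibonacci difference transform `F̂`:
`(F̂x)₀ = x₀` and `(F̂x)ₙ = (fₙ/fₙ₊₁)xₙ − (fₙ₊₁/fₙ)xₙ₋₁` for `n ≥ 1`. -/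
def Fhat (x : ℕ → ℝ) : ℕ → ℝ
  | 0 => x 0
  | n + 1 => (fibR (n + 1) / fibR (n + 2)) * x (n + 1) - (fibR (n + 2) / fibR (n + 1)) * x n

/-- The Fibonacci difference null space `c₀(F̂) = {x : (F̂x)ₙ → 0}`. -/
def c0FSet : Set (ℕ → ℝ) := {x | Tendsto (Fhat x) atTop (𝓝 0)}

/-- The Fibonacci difference convergent space `c(F̂) = {x : limₙ (F̂x)ₙ exists}`. -/
def cFSet : Set (ℕ → ℝ) := {x | ∃ l : ℝ, Tendsto (Fhat x) atTop (𝓝 l)}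

theorem fibR_pos (n : ℕ) : 0 < fibR n := by
  simp [fibR, Nat.fib_pos]

theorem tendsto_fibR_succ_div_fibR :
    Tendsto (fun n => fibR (n + 1) / fibR n) atTop (𝓝 Real.goldenRatio) :=
  tendsto_fib_succ_div_fib_atTop.comp (tendsto_add_atTop_nat 1)

theorem tendsto_fibR_div_fibR_succ :
    Tendsto (fun n => fibR n / fibR (n + 1)) atTop (𝓝 (-Real.goldenConj)) :=
  tendsto_fib_div_fib_succ_atTop.comp (tendsto_add_atTop_nat 1)

theorem tendsto_Fhat {x : ℕ → ℝ} {l : ℝ} (hx : Tendsto x atTop (𝓝 l)) :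
    Tendsto (Fhat x) atTop (𝓝 (-Real.goldenConj * l - Real.goldenRatio * l)) := by
  rw [← tendsto_add_atTop_iff_nat 1]
  have shift := tendsto_add_atTop_nat 1
  exact ((tendsto_fibR_div_fibR_succ.comp shift).mul (hx.comp shift)).sub
    ((tendsto_fibR_succ_div_fibR.comp shift).mul hx)

theorem Fhat_fibR_sq_succ (n : ℕ) : Fhat (fun k => fibR (k + 1) ^ 2) (n + 1) = 0 := by
  have h₁ := (fibR_pos (n + 1)).ne'
  have h₂ := (fibR_pos (n + 2)).ne'
  simp only [Fhat]
  field_simp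
  ring

theorem fibR_sq_mem_cFSet : (fun k : ℕ => fibR (k + 1) ^ 2) ∈ cFSet := by
  refine ⟨0, ?_⟩
  rw [← tendsto_add_atTop_iff_nat 1]
  simp only [Fhat_fibR_sq_succ, tendsto_const_nhds]

theorem tendsto_fibR_sq_atTop : Tendsto (fun k : ℕ => fibR (k + 1) ^ 2) atTop atTop := by
  have h : Tendsto (fun k : ℕ => fibR (k + 1)) atTop atTop :=
    tendsto_natCast_atTop_atTop.comp Nat.fib_add_two_strictMono.tendsto_atTop
  exact (tendsto_pow_atTop two_ne_zero).comp h

/-- The inclusion `c ⊂ c(F̂)` is strict: every convergent sequence `x` satisfies that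
`limₙ (F̂x)ₙ` exists, and `x = (f_{k+1}²)` belongs to `c(F̂)` but not to `c`. -/
theorem c_ssubset_cF :
    {x : ℕ → ℝ | ∃ l : ℝ, Tendsto x atTop (𝓝 l)} ⊂ cFSet ∧
    (fun k : ℕ => fibR (k + 1) ^ 2) ∈ cFSet ∧
    ¬ ∃ l : ℝ, Tendsto (fun k : ℕ => fibR (k + 1) ^ 2) atTop (𝓝 l) := by
  have not_conv : ¬ ∃ l : ℝ, Tendsto (fun k : ℕ => fibR (k + 1) ^ 2) atTop (𝓝 l) :=
    fun ⟨l, hl⟩ => not_tendsto_nhds_of_tendsto_atTop tendsto_fibR_sq_atTop l hl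
  exact ⟨⟨fun x ⟨l, hl⟩ => ⟨_, tendsto_Fhat hl⟩, fun h => not_conv (h fibR_sq_mem_cFSet)⟩,
    fibR_sq_mem_cFSet, not_conv⟩
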